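/- For reals p_1, …, p_h and x, the (h+1)×(h+1) determinant of the matrix with (using 0-based rows/columns) first row (1, −1, 0, …, 0), rows i = 1, …, h−1 having −p_{i−1} in column i−1 (where p_0 := x), 1 on the diagonal, p_h in the last column (for rows 1 ≤ i ≤ h−1), and last row (0, …, 0, −p_{h−1}, 1 + p_h), equals ∏_{j=1}^{h} p_j + (1 − x)·(1 + ∑_{k=2}^{h} ∏_{j=k}^{h} p_j). (This is the simplification of the Jacobian determinant identity (15) in the paper with p_j = ρ_h Φ'(η_{h,j}) and x = ρ_h Φ'(η_{h,0}).) -/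

import Mathlib

/-- Auxiliary matrix: unit lower bidiagonal plus a constant last column. -/
def auxE {R : Type*} [CommRing R] (n : ℕ) (q : ℕ → R) (c : R) :
    Matrix (Fin (n + 1)) (Fin (n + 1)) R :=
  Matrix.of fun i j => (if (i : ℕ) = j then 1 else 0) + (if (j : ℕ) = n then c else 0)
    - (if (i : ℕ) = j + 1 then q j else 0)

lemma auxE_succ {R : Type*} [CommRing R] (n : ℕ) (q : ℕ → R) (c : R) :
    (auxE (n + 1) q c).det
      = (auxE n (fun j => q (j + 1)) c).det + c * ∏ j ∈ Finset.range (n + 1), q j := by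
  have h1 : (auxE (n + 1) q c).submatrix Fin.succ (Fin.succAbove 0)
      = auxE n (fun j => q (j + 1)) c := by
    ext i j
    simp [auxE]
  have h2 : ((auxE (n + 1) q c).submatrix Fin.succ (Fin.succAbove (Fin.last (n + 1)))).det
      = ∏ j ∈ Finset.range (n + 1), - q j := by
    rw [Matrix.det_of_isUpperTriangular]
    · rw [← Fin.prod_univ_eq_prod_range (fun j => - q j)]
      refine Finset.prod_congr rfl fun i _ => ?_
      have := i.2
      simp [auxE]
      omega
    · intro i j hij
      have hij' : (j : ℕ) < i := hij
      have := i.2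
      simp only [auxE, Matrix.submatrix_apply, Matrix.of_apply, Fin.succAbove_last,
        Fin.val_succ, Fin.val_castSucc]
      rw [if_neg (by omega), if_neg (by omega), if_neg (by omega)]
      simp
  have e0 : auxE (n + 1) q c 0 0 = 1 := by simp [auxE]
  have e1 : auxE (n + 1) q c 0 (Fin.last (n + 1)) = c := by simp [auxE]
  have e2 : ∀ i : Fin n, auxE (n + 1) q c 0 i.castSucc.succ = 0 := by
    intro i
    have := i.2
    simp [auxE]
    omega
  rw [Matrix.det_succ_row_zero, Fin.sum_univ_succ, Fin.sum_univ_castSucc, h1, Fin.succ_last, h2]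
  rw [Finset.sum_eq_zero]
  · have hs : ((-1 : R)) ^ (n + 1) * (-1) ^ (n + 1) = 1 := by
      rw [← mul_pow]; simp
    rw [Finset.prod_neg, e0, e1]
    simp only [Fin.val_last, Finset.card_range, Fin.val_zero, Nat.succ_eq_add_one]
    linear_combination (c * ∏ j ∈ Finset.range (n + 1), q j) * hs
  · intro i _
    rw [e2]
    simp

lemma prod_shift {R : Type*} [CommRing R] (p : ℕ → R) (n s : ℕ) :
    ∏ k ∈ Finset.Icc s (n + s), p k = p (n + s) * ∏ j ∈ Finset.range n, p (j + s) := by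
  induction n with
  | zero => simp
  | succ n ih =>
    rw [show n + 1 + s = (n + s) + 1 by ring, Finset.prod_Icc_succ_top (by omega), ih,
      Finset.prod_range_succ]
    ring

lemma auxE_det {R : Type*} [CommRing R] (p : ℕ → R) (n s : ℕ) :
    (auxE n (fun j => p (j + s)) (p (n + s))).det
      = 1 + ∑ k ∈ Finset.Icc s (n + s), ∏ j ∈ Finset.Icc k (n + s), p j := by
  induction n generalizing s with
  | zero => simp [auxE, Matrix.det_unique]
  | succ n ih =>
    have e := ih (s + 1)
    rw [show n + (s + 1) = n + 1 + s by ring] at e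
    have f : (fun j => p (j + 1 + s)) = fun j => p (j + (s + 1)) := by
      funext j; congr 1; ring
    rw [auxE_succ, f, e, ← prod_shift]
    rw [← Finset.insert_Icc_add_one_left_eq_Icc (show s ≤ n + 1 + s by omega),
      Finset.sum_insert (by simp), Finset.insert_Icc_add_one_left_eq_Icc (by omega)]
    ring

/-- The Jacobian determinant identity: the (h+1)×(h+1) matrix with first row
(1, −1, 0, …, 0), rows 1 ≤ i ≤ h−1 having −p_{i−1} (with p_0 := x) in column
i−1, 1 on the diagonal and p_h in the last column, and last row
(0, …, 0, −p_{h−1}, 1 + p_h), has determinant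
∏_{j=1}^h p_j + (1 − x)·(1 + ∑_{k=2}^h ∏_{j=k}^h p_j). -/
theorem stmt_11 {R : Type*} [CommRing R] (h : ℕ) (hh : 2 ≤ h) (x : R) (p : ℕ → R) :
    (Matrix.of fun i j : Fin (h + 1) =>
        if (i : ℕ) = 0 then
          (if (j : ℕ) = 0 then (1 : R) else if (j : ℕ) = 1 then -1 else 0)
        else if (i : ℕ) = h then
          (if (j : ℕ) = h - 1 then -(p (h - 1)) else if (j : ℕ) = h then 1 + p h else 0)
        else
          if (j : ℕ) = (i : ℕ) - 1 then -(if (i : ℕ) = 1 then x else p ((i : ℕ) - 1))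
          else if (j : ℕ) = (i : ℕ) then 1
          else if (j : ℕ) = h then p h
          else 0).det
      = (∏ j ∈ Finset.Icc 1 h, p j)
        + (1 - x) * (1 + ∑ k ∈ Finset.Icc 2 h, ∏ j ∈ Finset.Icc k h, p j) := by
  obtain ⟨m, rfl⟩ : ∃ m, h = m + 2 := ⟨h - 2, by omega⟩
  clear hh
  rw [← auxE_det p m 2, show m + 2 = (m + 1) + 1 from rfl, prod_shift p (m + 1) 1]
  generalize hM : (Matrix.of _ : Matrix (Fin (m + 1 + 1 + 1)) (Fin (m + 1 + 1 + 1)) R) = M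
  have hA : M.submatrix Fin.succ (Fin.succAbove 0)
      = auxE (m + 1) (fun j => p (j + 1)) (p (m + 2)) := by
    subst hM
    ext i j
    have := i.2
    have := j.2
    simp only [auxE, Matrix.submatrix_apply, Matrix.of_apply, Fin.succAbove_zero, Fin.val_succ]
    grind
  have hB : (M.submatrix Fin.succ (Fin.succAbove 1)).submatrix Fin.succ Fin.succ
      = auxE m (fun j => p (j + 2)) (p (m + 2)) := by
    subst hM
    ext i j
    have := i.2
    have := j.2
    have e : Fin.succAbove (1 : Fin (m + 1 + 1 + 1)) j.succ = j.succ.succ := by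
      rw [← Fin.succ_zero_eq_one, Fin.succ_succAbove_succ, Fin.succAbove_zero]
    simp only [auxE, Matrix.submatrix_apply, Matrix.of_apply, e, Fin.val_succ]
    grind
  have hC : (M.submatrix Fin.succ (Fin.succAbove 1)).det
      = - x * (auxE m (fun j => p (j + 2)) (p (m + 2))).det := by
    rw [Matrix.det_succ_column_zero, Fin.sum_univ_succ, Finset.sum_eq_zero, Fin.succAbove_zero, hB]
    · have : M (Fin.succ 0) (Fin.succAbove 1 0) = - x := by
        subst hM
        simp
      simp only [Matrix.submatrix_apply, this]
      simp
    · intro i _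
      have : M i.succ.succ (Fin.succAbove 1 0) = 0 := by
        subst hM
        have := i.2
        simp
      simp only [Matrix.submatrix_apply, this]
      simp
  have h0 : M 0 0 = 1 := by subst hM; simp
  have h1 : M 0 1 = -1 := by subst hM; simp
  have h2 : ∀ i : Fin (m + 1), M 0 i.succ.succ = 0 := by subst hM; intro i; simp
  rw [Matrix.det_succ_row_zero, Fin.sum_univ_succ, Fin.sum_univ_succ, Finset.sum_eq_zero,
    Fin.succ_zero_eq_one, hA, hC, h0, h1, auxE_succ]
  · simp
    ring
  · intro i _
    rw [h2]; simp
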